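/- Let d ≥ 3 and k ≥ 1. There do not exist nonzero pairwise non-proportional binary forms f_1, f_2, f_3 of degree k over ℂ and nonzero scalars λ_1, λ_2, λ_3 ∈ ℂ such that λ_1 f_1^d + λ_2 f_2^d + λ_3 f_3^d = 0. (Equivalently, no 𝒲_k(3,d) set exists for d ≥ 3.) -/

import Mathlib

open MvPolynomial Finset

/-- A `𝒲_k(r,d)` set exists: there are `r` nonzero, pairwise non-proportional
binary forms of degree `k` over `ℂ` whose `d`-th powers admit a linear
dependence with all coefficients nonzero. -/
def ExistsWSet (k r d : ℕ) : Prop :=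
  ∃ (f : Fin r → MvPolynomial (Fin 2) ℂ) (lam : Fin r → ℂ),
    (∀ i, (f i).IsHomogeneous k) ∧ (∀ i, f i ≠ 0) ∧
    (∀ i j, i ≠ j → ∀ c : ℂ, f i ≠ c • f j) ∧
    (∀ i, lam i ≠ 0) ∧ ∑ i, lam i • f i ^ d = 0

/-- Evaluating a form of degree `k` at a scaled point scales the value by the `k`-th power. -/
theorem MvPolynomial.IsHomogeneous.eval_smul {σ R : Type*} [CommSemiring R] {k : ℕ}
    {f : MvPolynomial σ R} (hf : f.IsHomogeneous k) (c : R) (v : σ → R) :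
    eval (c • v) f = c ^ k * eval v f := by
  simp only [eval_eq, Finset.mul_sum]
  refine Finset.sum_congr rfl fun m hm => ?_
  have hm' : ∑ i ∈ m.support, m i = k := by
    exact (hf.degree_eq_sum_deg_support hm).symm
  simp only [Pi.smul_apply, smul_eq_mul, mul_pow, Finset.prod_mul_distrib,
    Finset.prod_pow_eq_pow_sum, hm']
  ring

/-- A homogeneous binary form is determined by its dehomogenization. -/
theorem MvPolynomial.IsHomogeneous.eq_zero_of_aeval_X_one_eq_zero {K : Type*} [Field K]
    [Infinite K] {k : ℕ} {f : MvPolynomial (Fin 2) K} (hf : f.IsHomogeneous k)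
    (h : MvPolynomial.aeval ![(Polynomial.X : Polynomial K), 1] f = 0) : f = 0 := by
  have key : f * X 1 = 0 := by
    refine MvPolynomial.funext fun v => ?_
    rw [map_mul, eval_X, map_zero]
    by_cases hv : v 1 = 0
    · rw [hv, mul_zero]
    have h1 : eval ![v 0 / v 1, 1] f = 0 := by
      have h2 := congrArg (Polynomial.aeval (v 0 / v 1)) h
      rw [← AlgHom.comp_apply, comp_aeval, map_zero] at h2
      rw [← h2, ← aeval_eq_eval]
      congr 2
      funext i
      fin_cases i <;> simp
    have h3 : v = v 1 • ![v 0 / v 1, 1] := by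
      ext i
      fin_cases i <;> simp [mul_div_cancel₀, hv]
    have h4 : eval v f = v 1 ^ k * eval ![v 0 / v 1, 1] f := by
      conv_lhs => rw [h3]
      exact hf.eval_smul _ _
    rw [h4, h1, mul_zero, zero_mul]
  exact (mul_eq_zero.mp key).resolve_right (X_ne_zero 1)

/-- Two polynomials occurring in a nontrivial Fermat-type relation are proportional. -/
theorem Polynomial.exists_eq_smul_of_fermat {K : Type*} [Field K] {d : ℕ} (hd : 3 ≤ d)
    (hdK : (d : K) ≠ 0) {p q r : Polynomial K} (hp : p ≠ 0) (hq : q ≠ 0) (hr : r ≠ 0)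
    {u v w : K} (hu : u ≠ 0) (hv : v ≠ 0) (hw : w ≠ 0)
    (h : u • p ^ d + v • q ^ d + w • r ^ d = 0) : ∃ c : K, p = c • q := by
  classical
  obtain ⟨a, b, ha, hb, hab⟩ := _root_.extract_gcd p q
  rw [gcd_isUnit_iff] at hab
  generalize gcd p q = g at ha hb
  subst ha hb
  obtain ⟨hg, ha⟩ := mul_ne_zero_iff.mp hp
  have hb := right_ne_zero_of_mul hq
  obtain ⟨c, rfl⟩ : g ∣ r := by
    rw [← IsIntegrallyClosed.pow_dvd_pow_iff (n := d) (by lia)]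
    refine ⟨-(w⁻¹ • (u • a ^ d + v • b ^ d)), ?_⟩
    have hr' : r ^ d = -(w⁻¹ • (u • (g * a) ^ d + v • (g * b) ^ d)) := by
      rw [eq_neg_of_add_eq_zero_left h, smul_neg, neg_neg, inv_smul_smul₀ hw]
    rw [hr', mul_pow, mul_pow, mul_neg, mul_smul_comm, mul_add, mul_smul_comm, mul_smul_comm]
  have hrel : C u * a ^ d + C v * b ^ d + C w * c ^ d = 0 := by
    refine (mul_eq_zero.mp ?_).resolve_left (pow_ne_zero d hg)
    rw [← h]
    simp only [smul_eq_C_mul]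
    ring
  have hd0 : d ≠ 0 := by lia
  obtain ⟨ha0, hb0, -⟩ := flt_catalan hd0 hd0 hd0 (by nlinarith [mul_le_mul_left hd (d * d)])
    hdK hdK hdK ha hb (right_ne_zero_of_mul hr) hab hu hv hw hrel
  obtain ⟨x, rfl⟩ := natDegree_eq_zero.mp ha0
  obtain ⟨y, rfl⟩ := natDegree_eq_zero.mp hb0
  have hy : y ≠ 0 := by rintro rfl; exact hb C_0
  refine ⟨x / y, ?_⟩
  rw [smul_eq_C_mul, mul_left_comm, ← C_mul, div_mul_cancel₀ x hy]

/-- (Liouville) For `d ≥ 3` and `k ≥ 1`, no `𝒲_k(3,d)` set exists. -/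
theorem no_W_three_set (d k : ℕ) (hd : 3 ≤ d) (hk : 1 ≤ k) :
    ¬ ExistsWSet k 3 d := by
  rintro ⟨f, lam, hf, hf0, hprop, hlam, hsum⟩
  have hφ : ∀ i, MvPolynomial.aeval ![(Polynomial.X : Polynomial ℂ), 1] (f i) ≠ 0 := fun i h =>
    hf0 i ((hf i).eq_zero_of_aeval_X_one_eq_zero h)
  have hrel := congrArg (MvPolynomial.aeval ![(Polynomial.X : Polynomial ℂ), 1]) hsum
  simp only [Fin.sum_univ_three, map_add, map_smul, map_pow, map_zero] at hrel
  obtain ⟨c, hc⟩ := Polynomial.exists_eq_smul_of_fermat hd (by norm_cast; lia)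
    (hφ 0) (hφ 1) (hφ 2) (hlam 0) (hlam 1) (hlam 2) hrel
  refine hprop 0 1 (by decide) c (sub_eq_zero.mp ?_)
  have hc1 : (c • f 1).IsHomogeneous k := by
    rw [smul_eq_C_mul]
    exact (hf 1).C_mul c
  refine ((hf 0).sub hc1).eq_zero_of_aeval_X_one_eq_zero ?_
  rw [map_sub, map_smul, hc, sub_self]
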